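/- arXiv:1002.5045 — 2 statements merged into one kernel-verified Lean document; each statement's English description precedes it below -/
import Mathlib

section
/- Let N_{μν} : ℝ → ℝ for μ, ν ∈ {0,1,2,3} be C¹ functions with N_{μν} = N_{νμ}, let P⁰, P¹, P², P³ : ℝ → ℝ be C¹, let a₁, a₂, a₃ : ℝ → ℝ be continuous, and let F_{μν} : ℝ → ℝ be continuous with F_{μν} = −F_{νμ}. Suppose that for every test function f : ℝ⁴ → ℝ the following hold: (charge conservation) ∫_ℝ [ ((P⁰)′(t) + Σᵢ aᵢ(t)Pⁱ(t))·f(t,0) + Σᵢ Pⁱ(t)·(∂ᵢf)(t,0) ] dt = 0; (stress-energy, ν = 0) ∫_ℝ [ (−N₀₀′(t) + Σᵢ aᵢ(t)N_{i0}(t) − Σ_{μ} P^{μ}(t)F_{μ0}(t))·f(t,0) + Σᵢ N_{i0}(t)·(∂ᵢf)(t,0) ] dt = 0; and for each j ∈ {1,2,3}, ∫_ℝ [ (−N_{0j}′(t) + Σᵢ aᵢ(t)N_{ij}(t) + a_j(t)N₀₀(t) − Σ_{μ} P^{μ}(t)F_{μj}(t))·f(t,0) + Σᵢ N_{ij}(t)·(∂ᵢf)(t,0)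 ] dt = 0. Then Pⁱ ≡ 0 for i ∈ {1,2,3}, P⁰ is constant, N_{i0} ≡ 0 and N_{ij} ≡ 0 for all i, j ∈ {1,2,3}, N₀₀ is constant, and N₀₀(t)·a_j(t) = P⁰(t)·F_{0j}(t) for all t and j (the Lorentz force law). -/
open MeasureTheory

/-- The point (t, 0, 0, 0) of ℝ⁴. -/
noncomputable def worldlinePt (t : ℝ) : Fin 4 → ℝ := fun μ => if μ = 0 then t else 0

/-- A test function on ℝ⁴: smooth and compactly supported. -/
def IsTestFunction (f : (Fin 4 → ℝ) → ℝ) : Prop :=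
  ContDiff ℝ (⊤ : ℕ∞) f ∧ HasCompactSupport f

lemma key_aux (A : ℝ → ℝ) (B : Fin 3 → ℝ → ℝ) (hA : Continuous A) (hB : ∀ i, Continuous (B i))
    (H : ∀ f : (Fin 4 → ℝ) → ℝ, IsTestFunction f →
      ∫ t : ℝ, (A t * f (worldlinePt t) +
        ∑ i : Fin 3, B i t * fderiv ℝ f (worldlinePt t) (Pi.single i.succ 1)) = 0)
    (h : (Fin 3 → ℝ) → ℝ) (hh : ContDiff ℝ (⊤ : ℕ∞) h) (hc : HasCompactSupport h) (t : ℝ) :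
    A t * h 0 + ∑ i : Fin 3, B i t * fderiv ℝ h 0 (Pi.single i 1) = 0 := by
  have hcont : Continuous (fun t => A t * h 0 + ∑ i : Fin 3, B i t * fderiv ℝ h 0 (Pi.single i 1)) := by
    fun_prop
  have hae : ∀ᵐ t : ℝ, A t * h 0 + ∑ i : Fin 3, B i t * fderiv ℝ h 0 (Pi.single i 1) = 0 := by
    refine ae_eq_zero_of_integral_contDiff_smul_eq_zero hcont.locallyIntegrable ?_
    intro g hg hgc
    let T : (Fin 4 → ℝ) →L[ℝ] (Fin 3 → ℝ) :=
      ContinuousLinearMap.pi fun i => ContinuousLinearMap.proj i.succ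
    have hTw : ∀ t, T (worldlinePt t) = 0 := by
      intro t; ext i; simp [T, worldlinePt]
    have hTs : ∀ i : Fin 3, T (Pi.single i.succ 1) = Pi.single i 1 := by
      intro i; ext j; simp [T, Pi.single_apply]
    let f : (Fin 4 → ℝ) → ℝ := fun x => g (x 0) * h (T x)
    have hf : IsTestFunction f := by
      constructor
      · exact (hg.comp (contDiff_apply ℝ ℝ (0 : Fin 4))).mul (hh.comp T.contDiff)
      · have hK : IsCompact ((fun p : ℝ × (Fin 3 → ℝ) => (Fin.cons p.1 p.2 : Fin 4 → ℝ)) ''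
            (tsupport g ×ˢ tsupport h)) := by
          refine (hgc.isCompact.prod hc.isCompact).image ?_
          refine continuous_pi fun i => ?_
          refine Fin.cases ?_ (fun i => ?_) i
          · simpa using continuous_fst
          · simp only [Fin.cons_succ]; fun_prop
        refine HasCompactSupport.intro hK ?_
        intro x hx
        by_contra hne
        have h1 : g (x 0) ≠ 0 := fun h' => hne (by simp [f, h'])
        have h2 : h (T x) ≠ 0 := fun h' => hne (by simp [f, h'])
        refine hx ⟨(x 0, T x), ⟨subset_tsupport _ h1, subset_tsupport _ h2⟩, ?_⟩
        ext i
        refine Fin.cases ?_ (fun i => ?_) i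
        · simp
        · simp [T]
    have hd : ∀ (t : ℝ) (i : Fin 3), fderiv ℝ f (worldlinePt t) (Pi.single i.succ 1)
        = g t * fderiv ℝ h 0 (Pi.single i 1) := by
      intro t i
      have hg1 : HasFDerivAt (fun x : Fin 4 → ℝ => g (x 0))
          ((fderiv ℝ g t).comp (ContinuousLinearMap.proj (R := ℝ) (φ := fun _ : Fin 4 => ℝ) 0)) (worldlinePt t) := by
        have : HasFDerivAt g (fderiv ℝ g t) (worldlinePt t 0) := by
          have e : worldlinePt t 0 = t := by simp [worldlinePt]
          rw [e]
          exact (hg.differentiable (by simp) t).hasFDerivAt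
        exact this.comp (worldlinePt t)
          (ContinuousLinearMap.proj (R := ℝ) (φ := fun _ : Fin 4 => ℝ) 0).hasFDerivAt
      have hh1 : HasFDerivAt (fun x => h (T x)) ((fderiv ℝ h 0).comp T) (worldlinePt t) := by
        have : HasFDerivAt h (fderiv ℝ h 0) (T (worldlinePt t)) := by
          rw [hTw]
          exact (hh.differentiable (by simp) 0).hasFDerivAt
        exact this.comp (worldlinePt t) T.hasFDerivAt
      have := (hg1.mul hh1).fderiv
      change fderiv ℝ f (worldlinePt t) = _ at this
      rw [this]
      simp [hTs, worldlinePt]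
    have := H f hf
    rw [← this]
    congr 1
    ext t
    simp only [hd, smul_eq_mul, f, hTw]
    have e : worldlinePt t 0 = t := by simp [worldlinePt]
    rw [e, mul_add, Finset.mul_sum]
    congr 1
    · ring
    · exact Finset.sum_congr rfl fun i _ => by ring
  have := (hcont.ae_eq_iff_eq volume continuous_const).1 hae
  exact congrFun this t

lemma key (A : ℝ → ℝ) (B : Fin 3 → ℝ → ℝ) (hA : Continuous A) (hB : ∀ i, Continuous (B i))
    (H : ∀ f : (Fin 4 → ℝ) → ℝ, IsTestFunction f →
      ∫ t : ℝ, (A t * f (worldlinePt t) +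
        ∑ i : Fin 3, B i t * fderiv ℝ f (worldlinePt t) (Pi.single i.succ 1)) = 0) :
    (∀ t, A t = 0) ∧ ∀ i t, B i t = 0 := by
  let ψ : ContDiffBump (0 : Fin 3 → ℝ) := ⟨1, 2, one_pos, one_lt_two⟩
  have h1 : ψ 0 = 1 := ψ.eventuallyEq_one.self_of_nhds
  constructor
  · intro t
    have := key_aux A B hA hB H ψ ψ.contDiff ψ.hasCompactSupport t
    have hz : fderiv ℝ ψ 0 = 0 := by
      rw [ψ.eventuallyEq_one.fderiv_eq]
      exact fderiv_const_apply (1 : ℝ)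
    simpa [h1, hz] using this
  · intro k t
    have := key_aux A B hA hB H (fun y => ψ y * y k)
      (ψ.contDiff.mul (contDiff_apply ℝ ℝ k)) ψ.hasCompactSupport.mul_right t
    have hz : fderiv ℝ (fun y => ψ y * y k) 0
        = ContinuousLinearMap.proj (R := ℝ) (φ := fun _ : Fin 3 => ℝ) k := by
      have : (fun y => ψ y * y k) =ᶠ[nhds 0]
          (ContinuousLinearMap.proj (R := ℝ) (φ := fun _ : Fin 3 => ℝ) k) := by
        filter_upwards [ψ.eventuallyEq_one] with y hy
        simp [hy]
      rw [this.fderiv_eq, ContinuousLinearMap.fderiv]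
    rw [hz] at this
    simpa [Pi.single_apply] using this

/-- For vector-tensor theories with the Maxwell gauge symmetry: the distributional
charge-conservation identity ∇_μ(P^μ δ³(x)) = 0 and stress-energy identity
∇^μ(N_{μν} δ³(x)) = P^μ F_{μν} δ³(x), written in Fermi normal coordinates with acceleration
aᵢ(t) and worldline field strength F_{μν}(t), imply Pⁱ = 0, constancy of the charge P⁰,
N_{i0} = N_{ij} = 0, constancy of the mass N₀₀, and the Lorentz force law
N₀₀ a_j = P⁰ F_{0j}. -/
theorem stmt_5 (N : Fin 4 → Fin 4 → ℝ → ℝ) (P : Fin 4 → ℝ → ℝ) (a : Fin 3 → ℝ → ℝ)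
    (F : Fin 4 → Fin 4 → ℝ → ℝ)
    (hN : ∀ μ ν, ContDiff ℝ 1 (N μ ν)) (hNsym : ∀ μ ν, N μ ν = N ν μ)
    (hP : ∀ μ, ContDiff ℝ 1 (P μ)) (ha : ∀ i, Continuous (a i))
    (hF : ∀ μ ν, Continuous (F μ ν)) (hFanti : ∀ μ ν, F μ ν = fun t => - F ν μ t)
    (hcharge : ∀ f : (Fin 4 → ℝ) → ℝ, IsTestFunction f →
      ∫ t : ℝ, ((deriv (P 0) t + ∑ i : Fin 3, a i t * P i.succ t) * f (worldlinePt t) +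
        ∑ i : Fin 3, P i.succ t * fderiv ℝ f (worldlinePt t) (Pi.single i.succ 1)) = 0)
    (h0 : ∀ f : (Fin 4 → ℝ) → ℝ, IsTestFunction f →
      ∫ t : ℝ, ((- deriv (N 0 0) t + ∑ i : Fin 3, a i t * N i.succ 0 t
          - ∑ μ : Fin 4, P μ t * F μ 0 t) * f (worldlinePt t) +
        ∑ i : Fin 3, N i.succ 0 t * fderiv ℝ f (worldlinePt t) (Pi.single i.succ 1)) = 0)
    (hj : ∀ (j : Fin 3) (f : (Fin 4 → ℝ) → ℝ), IsTestFunction f →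
      ∫ t : ℝ, ((- deriv (N 0 j.succ) t + ∑ i : Fin 3, a i t * N i.succ j.succ t
          + a j t * N 0 0 t - ∑ μ : Fin 4, P μ t * F μ j.succ t) * f (worldlinePt t) +
        ∑ i : Fin 3, N i.succ j.succ t * fderiv ℝ f (worldlinePt t) (Pi.single i.succ 1)) = 0) :
    (∀ (i : Fin 3) (t : ℝ), P i.succ t = 0) ∧
    (∃ q : ℝ, ∀ t : ℝ, P 0 t = q) ∧
    (∀ (i : Fin 3) (t : ℝ), N i.succ 0 t = 0) ∧
    (∀ (i j : Fin 3) (t : ℝ), N i.succ j.succ t = 0) ∧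
    (∃ m : ℝ, ∀ t : ℝ, N 0 0 t = m) ∧
    (∀ (j : Fin 3) (t : ℝ), N 0 0 t * a j t = P 0 t * F 0 j.succ t) := by
  have dP : Continuous (deriv (P 0)) := (hP 0).continuous_deriv (by simp)
  have dN : ∀ μ ν, Continuous (deriv (N μ ν)) := fun μ ν => (hN μ ν).continuous_deriv (by simp)
  have cP : ∀ μ, Continuous (P μ) := fun μ => (hP μ).continuous
  have cN : ∀ μ ν, Continuous (N μ ν) := fun μ ν => (hN μ ν).continuous
  obtain ⟨p1, p2⟩ := key _ (fun i => P i.succ) (by fun_prop) (fun i => cP _) hcharge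
  obtain ⟨n1, n2⟩ := key _ (fun i => N i.succ 0) (by fun_prop) (fun i => cN _ _) h0
  have hk := fun j => key _ (fun i => N i.succ j.succ) (by fun_prop) (fun i => cN _ _) (hj j)
  have m2 : ∀ i j t, N (Fin.succ i) (Fin.succ j) t = 0 := fun i j t => (hk j).2 i t
  have F00 : ∀ t, F 0 0 t = 0 := fun t => by
    have := congrFun (hFanti 0 0) t
    linarith
  refine ⟨p2, ⟨P 0 0, fun t => ?_⟩, n2, m2, ⟨N 0 0 0, fun t => ?_⟩, ?_⟩
  · refine is_const_of_deriv_eq_zero ((hP 0).differentiable (by simp)) (fun t => ?_) t 0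
    have := p1 t
    simpa only [p2, mul_zero, Finset.sum_const_zero, add_zero] using this
  · refine is_const_of_deriv_eq_zero ((hN 0 0).differentiable (by simp)) (fun t => ?_) t 0
    have := n1 t
    rw [Fin.sum_univ_succ (n := 3)] at this
    simp only [p2, n2, F00, mul_zero, zero_mul, Finset.sum_const_zero, add_zero] at this
    linarith
  · intro j t
    have := (hk j).1 t
    have hz : N 0 j.succ = fun _ => 0 := by
      rw [hNsym]; exact funext (n2 j)
    rw [Fin.sum_univ_succ (n := 3)] at this
    simp only [p2, m2, hz, deriv_const, mul_zero, zero_mul, Finset.sum_const_zero, add_zero] at this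
    linarith
end

section
/- Let N_{μν} : ℝ → ℝ for μ, ν ∈ {0,1,2,3} be C¹ functions with N_{μν} = N_{νμ}, and let F, G₁, G₂, G₃, H₁, H₂, H₃, K_{ij} (for i, j ∈ {1,2,3}), a₁, a₂, a₃ : ℝ → ℝ be continuous. Suppose that for every test function f : ℝ⁴ → ℝ the following hold: ∫_ℝ [ (−N₀₀′(t) + Σᵢ aᵢ(t)N_{i0}(t) − F(t))·f(t,0) + Σᵢ (N_{i0}(t) − Gᵢ(t))·(∂ᵢf)(t,0) ] dt = 0, and for each j ∈ {1,2,3}, ∫_ℝ [ (−N_{0j}′(t) + Σᵢ aᵢ(t)N_{ij}(t) + a_j(t)N₀₀(t) − H_j(t))·f(t,0) + Σᵢ (N_{ij}(t) − K_{ij}(t))·(∂ᵢf)(t,0) ] dt = 0. Then N_{i0} = Gᵢ and N_{ij} = K_{ij} identically; moreover, writing M := N₀₀, each G_j is differentiable and for all t: M′(t) = Σᵢ aᵢ(t)Gᵢ(t) − F(t) and M(t)·a_j(t) = G_j′(t) − Σᵢ aᵢ(t)K_{ij}(t) + H_j(t) for each j. -/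
open MeasureTheory

open scoped ContDiff in
/-- For prescribed data `c, d`, there is a test function with `f(t,0) = g t * c` and
`∂ᵢ f (t,0) = g t * dᵢ`. -/
lemma exists_test (g : ℝ → ℝ) (hg : ContDiff ℝ ∞ g) (hgs : HasCompactSupport g)
    (c : ℝ) (d : Fin 3 → ℝ) :
    ∃ f : (Fin 4 → ℝ) → ℝ, IsTestFunction f ∧
      (∀ t, f (worldlinePt t) = g t * c) ∧
      (∀ t (i : Fin 3), fderiv ℝ f (worldlinePt t) (Pi.single i.succ 1) = g t * d i) := by
  let χ : ContDiffBump (0 : ℝ) := ⟨1, 2, by norm_num, by norm_num⟩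
  have hχ : ContDiff ℝ ∞ (χ : ℝ → ℝ) := χ.contDiff
  let L : (Fin 4 → ℝ) → ℝ := fun x => c + ∑ k : Fin 3, d k * x k.succ
  let h : (Fin 4 → ℝ) → ℝ := fun x => g (x 0) * ∏ k : Fin 3, χ (x k.succ)
  have hL : ContDiff ℝ ∞ L := by
    refine contDiff_const.add (ContDiff.sum fun k _ => contDiff_const.mul (contDiff_apply ℝ ℝ _))
  have hh : ContDiff ℝ ∞ h := by
    refine (hg.comp (contDiff_apply ℝ ℝ _)).mul (contDiff_prod fun k _ => ?_)
    exact hχ.comp (contDiff_apply ℝ ℝ k.succ)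
  have hhs : HasCompactSupport h := by
    let S : Fin 4 → Set ℝ := Fin.cons (tsupport g) (fun _ => tsupport χ)
    have hS : ∀ μ, IsCompact (S μ) := by
      intro μ
      refine Fin.cases ?_ (fun k => ?_) μ
      · exact hgs
      · exact χ.hasCompactSupport
    refine HasCompactSupport.intro (isCompact_univ_pi hS) ?_
    intro x hx
    by_contra hne
    apply hx
    intro μ _
    have h1 : g (x 0) ≠ 0 := left_ne_zero_of_mul hne
    have h2 := Finset.prod_ne_zero_iff.1 (right_ne_zero_of_mul hne)
    refine Fin.cases ?_ (fun k => ?_) μ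
    · exact subset_tsupport _ h1
    · exact subset_tsupport _ (h2 k (Finset.mem_univ _))
  have hev : ∀ t, (fun x => h x * L x) =ᶠ[nhds (worldlinePt t)] fun x => g (x 0) * L x := by
    intro t
    have h3 : ∀ k : Fin 3, ∀ᶠ x : Fin 4 → ℝ in nhds (worldlinePt t), χ (x k.succ) = 1 := by
      intro k
      have h4 : Filter.Tendsto (fun x : Fin 4 → ℝ => x k.succ) (nhds (worldlinePt t))
          (nhds (0 : ℝ)) := by
        have := (continuous_apply (A := fun _ : Fin 4 => ℝ) k.succ).tendsto (worldlinePt t)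
        simpa [worldlinePt] using this
      exact h4.eventually χ.eventuallyEq_one
    filter_upwards [Filter.eventually_all.2 h3] with x hx
    simp [h, hx]
  refine ⟨fun x => h x * L x, ⟨hh.mul hL, hhs.mul_right⟩, fun t => ?_, fun t i => ?_⟩
  · refine (hev t).eq_of_nhds.trans ?_
    simp [L, worldlinePt]
  · rw [(hev t).fderiv_eq]
    have hgd : HasFDerivAt (fun x : Fin 4 → ℝ => g (x 0))
        (deriv g (worldlinePt t 0) • ContinuousLinearMap.proj (R := ℝ) (φ := fun _ : Fin 4 => ℝ) 0)
        (worldlinePt t) := by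
      have hd : HasDerivAt g (deriv g (worldlinePt t 0)) (worldlinePt t 0) :=
        (hg.differentiable (by simp) _).hasDerivAt
      exact hd.comp_hasFDerivAt (worldlinePt t) (hasFDerivAt_apply 0 (worldlinePt t))
    have hLd : HasFDerivAt L
        (∑ k : Fin 3, d k • ContinuousLinearMap.proj (R := ℝ) (φ := fun _ : Fin 4 => ℝ) k.succ)
        (worldlinePt t) := by
      refine HasFDerivAt.const_add c (HasFDerivAt.fun_sum fun k _ => ?_)
      exact (hasFDerivAt_apply k.succ (worldlinePt t)).const_mul (d k)
    rw [(hgd.fun_mul hLd).fderiv]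
    simp [worldlinePt, Pi.single_apply]

lemma weak_zero (A : ℝ → ℝ) (B : Fin 3 → ℝ → ℝ) (hA : Continuous A) (hB : ∀ i, Continuous (B i))
    (h : ∀ f : (Fin 4 → ℝ) → ℝ, IsTestFunction f →
      ∫ t : ℝ, (A t * f (worldlinePt t) +
        ∑ i : Fin 3, B i t * fderiv ℝ f (worldlinePt t) (Pi.single i.succ 1)) = 0) :
    (∀ t, A t = 0) ∧ ∀ i t, B i t = 0 := by
  have key : ∀ (c : ℝ) (d : Fin 3 → ℝ) (t : ℝ), A t * c + ∑ i, B i t * d i = 0 := by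
    intro c d
    have hc : Continuous fun t => A t * c + ∑ i, B i t * d i := by fun_prop
    have hae := ae_eq_zero_of_integral_contDiff_smul_eq_zero (μ := volume)
      hc.locallyIntegrable (fun g hg hgs => by
        obtain ⟨f, hf, hf1, hf2⟩ := exists_test g hg hgs c d
        rw [← h f hf]
        congr 1
        ext t
        simp only [hf1, hf2, smul_eq_mul, mul_add, Finset.mul_sum]
        congr 1
        · ring
        · exact Finset.sum_congr rfl fun i _ => by ring)
    have := (hc.ae_eq_iff_eq volume (continuous_const (y := (0 : ℝ)))).1 hae
    exact fun t => congrFun this t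
  refine ⟨fun t => by simpa using key 1 0 t, fun i t => ?_⟩
  simpa [Pi.single_apply] using key 0 (Pi.single i 1) t

/-- The Fermi-normal-coordinate algebraic core of the general theorem of Section V:
from the weak form of the distributional Bianchi identity with local source functions
F, Gᵢ, Hᵢ, K_{ij}, one gets N_{i0} = Gᵢ, N_{ij} = K_{ij}, the mass-evolution law
M′ = Σᵢ aᵢGᵢ − F, and the force law M a_j = G_j′ − Σᵢ aᵢ K_{ij} + H_j, where M = N₀₀. -/
theorem stmt_6 (N : Fin 4 → Fin 4 → ℝ → ℝ) (F : ℝ → ℝ) (G H : Fin 3 → ℝ → ℝ)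
    (K : Fin 3 → Fin 3 → ℝ → ℝ) (a : Fin 3 → ℝ → ℝ)
    (hN : ∀ μ ν, ContDiff ℝ 1 (N μ ν)) (hNsym : ∀ μ ν, N μ ν = N ν μ)
    (hF : Continuous F) (hG : ∀ i, Continuous (G i)) (hH : ∀ i, Continuous (H i))
    (hK : ∀ i j, Continuous (K i j)) (ha : ∀ i, Continuous (a i))
    (h0 : ∀ f : (Fin 4 → ℝ) → ℝ, IsTestFunction f →
      ∫ t : ℝ, ((- deriv (N 0 0) t + ∑ i : Fin 3, a i t * N i.succ 0 t - F t) *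
          f (worldlinePt t) +
        ∑ i : Fin 3, (N i.succ 0 t - G i t) *
          fderiv ℝ f (worldlinePt t) (Pi.single i.succ 1)) = 0)
    (hj : ∀ (j : Fin 3) (f : (Fin 4 → ℝ) → ℝ), IsTestFunction f →
      ∫ t : ℝ, ((- deriv (N 0 j.succ) t + ∑ i : Fin 3, a i t * N i.succ j.succ t
          + a j t * N 0 0 t - H j t) * f (worldlinePt t) +
        ∑ i : Fin 3, (N i.succ j.succ t - K i j t) *
          fderiv ℝ f (worldlinePt t) (Pi.single i.succ 1)) = 0) :
    (∀ (i : Fin 3) (t : ℝ), N i.succ 0 t = G i t) ∧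
    (∀ (i j : Fin 3) (t : ℝ), N i.succ j.succ t = K i j t) ∧
    (∀ (j : Fin 3), Differentiable ℝ (G j)) ∧
    (∀ t : ℝ, deriv (N 0 0) t = ∑ i : Fin 3, a i t * G i t - F t) ∧
    (∀ (j : Fin 3) (t : ℝ), N 0 0 t * a j t =
      deriv (G j) t - ∑ i : Fin 3, a i t * K i j t + H j t) := by
  have hd : ∀ μ ν, Continuous (deriv (N μ ν)) := fun μ ν => (hN μ ν).continuous_deriv le_rfl
  have hc : ∀ μ ν, Continuous (N μ ν) := fun μ ν => (hN μ ν).continuous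
  obtain ⟨hA, hB⟩ := weak_zero
    (fun t => - deriv (N 0 0) t + ∑ i : Fin 3, a i t * N i.succ 0 t - F t)
    (fun i t => N i.succ 0 t - G i t)
    (((hd 0 0).neg.add (continuous_finsetSum _ fun i _ => (ha i).mul (hc _ _))).sub hF)
    (fun i => (hc _ _).sub (hG i)) h0
  have hJ := fun j : Fin 3 => weak_zero
    (fun t => - deriv (N 0 j.succ) t + ∑ i : Fin 3, a i t * N i.succ j.succ t
          + a j t * N 0 0 t - H j t)
    (fun i t => N i.succ j.succ t - K i j t)
    ((((hd 0 j.succ).neg.add (continuous_finsetSum _ fun i _ => (ha i).mul (hc _ _))).add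
      ((ha j).mul (hc 0 0))).sub (hH j))
    (fun i => (hc _ _).sub (hK i j)) (hj j)
  have e1 : ∀ (i : Fin 3) (t : ℝ), N i.succ 0 t = G i t := fun i t => sub_eq_zero.1 (hB i t)
  have e2 : ∀ (i j : Fin 3) (t : ℝ), N i.succ j.succ t = K i j t :=
    fun i j t => sub_eq_zero.1 ((hJ j).2 i t)
  have e3 : ∀ i : Fin 3, G i = N i.succ 0 := fun i => funext fun t => (e1 i t).symm
  refine ⟨e1, e2, fun j => ?_, fun t => ?_, fun j t => ?_⟩
  · rw [e3]
    exact (hN _ _).differentiable (by simp)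
  · have := hA t
    simp only [e1] at this
    linarith
  · have := (hJ j).1 t
    simp only [e2] at this
    rw [e3, hNsym j.succ 0]
    linarith
end
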